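/- arXiv:1709.06256 — 4 statements merged into one kernel-verified Lean document; each statement's English description precedes it below -/
import Mathlib

section
/- Let F₀ : (Fin d → ℝ) → ℝ be continuous on the box B = {x : 0 ≤ x ≤ τ} (componentwise inequalities, τ with strictly positive coordinates), and let (Fₙ) be a sequence of functions (Fin d → ℝ) → ℝ, each of which is monotone nondecreasing on B with respect to the componentwise partial order (x ≤ y componentwise implies Fₙ(x) ≤ Fₙ(y)). If Fₙ(x) → F₀(x) as n → ∞ for every x ∈ B, then Fₙ converges to F₀ uniformly on B, i.e. sup_{x ∈ B} |Fₙ(x) − F₀(x)| → 0. -/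
open Filter Topology Set

/-- Monotone functions on a box of `ι → ℝ` that converge pointwise to a function continuous on
the box converge locally uniformly there. -/
theorem tendstoLocallyUniformlyOn_Icc_of_monotoneOn {α ι : Type*} [Fintype ι] {l : Filter α}
    {a b : ι → ℝ} {F : α → (ι → ℝ) → ℝ} {f : (ι → ℝ) → ℝ}
    (hmono : ∀ n, MonotoneOn (F n) (Set.Icc a b)) (hcont : ContinuousOn f (Set.Icc a b))
    (hpt : ∀ x ∈ Set.Icc a b, Tendsto (fun n => F n x) l (𝓝 (f x))) :
    TendstoLocallyUniformlyOn F f l (Set.Icc a b) := by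
  rw [Metric.tendstoLocallyUniformlyOn_iff]
  intro ε hε x hx
  obtain ⟨δ, hδ, hf⟩ := Metric.continuousOn_iff.1 hcont x hx (ε / 4) (by positivity)
  let p : ι → ℝ := fun i => max (x i - δ / 2) (a i)
  let q : ι → ℝ := fun i => min (x i + δ / 2) (b i)
  have hpx : p ≤ x := fun i => max_le (by linarith) (hx.1 i)
  have hxq : x ≤ q := fun i => le_min (by linarith) (hx.2 i)
  have hp : p ∈ Set.Icc a b := ⟨fun i => le_max_right _ _, hpx.trans hx.2⟩
  have hq : q ∈ Set.Icc a b := ⟨hx.1.trans hxq, fun i => min_le_right _ _⟩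
  have hpd : dist p x < δ := by
    refine ((dist_pi_le_iff (half_pos hδ).le).2 fun i => ?_).trans_lt (half_lt_self hδ)
    rw [Real.dist_eq, abs_le]
    have h₁ : x i - δ / 2 ≤ p i := le_max_left _ _
    constructor <;> linarith [hpx i]
  have hqd : dist q x < δ := by
    refine ((dist_pi_le_iff (half_pos hδ).le).2 fun i => ?_).trans_lt (half_lt_self hδ)
    rw [Real.dist_eq, abs_le]
    have h₁ : q i ≤ x i + δ / 2 := min_le_left _ _
    constructor <;> linarith [hxq i]
  refine ⟨Metric.ball x (δ / 2) ∩ Set.Icc a b,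
    inter_mem (mem_nhdsWithin_of_mem_nhds (Metric.ball_mem_nhds x (half_pos hδ)))
      self_mem_nhdsWithin, ?_⟩
  filter_upwards [Metric.tendsto_nhds.1 (hpt p hp) (ε / 4) (by positivity),
    Metric.tendsto_nhds.1 (hpt q hq) (ε / 4) (by positivity)] with n hnp hnq y hy
  have hyi : ∀ i, |y i - x i| < δ / 2 := fun i =>
    (dist_le_pi_dist y x i).trans_lt (Metric.mem_ball.1 hy.1)
  have hpy : p ≤ y := fun i =>
    max_le (by linarith [(abs_lt.1 (hyi i)).1]) (hy.2.1 i)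
  have hyq : y ≤ q := fun i =>
    le_min (by linarith [(abs_lt.1 (hyi i)).2]) (hy.2.2 i)
  have hFp := hmono n hp hy.2 hpy
  have hFq := hmono n hy.2 hq hyq
  have hfp := hf p hp hpd
  have hfq := hf q hq hqd
  have hfy := hf y hy.2 ((Metric.mem_ball.1 hy.1).trans (half_lt_self hδ))
  simp only [Real.dist_eq, abs_lt] at *
  constructor <;> linarith

/-- **Lemma 5 (multivariate pointwise-to-uniform for monotone functions).**
If each `F n` is monotone nondecreasing on the box `B = Icc 0 τ` (componentwise order,
`τ` with strictly positive coordinates), `F₀` is continuous on `B`, and `F n x → F₀ x`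
for every `x ∈ B`, then `F n → F₀` uniformly on `B`. -/
theorem pointwise_to_uniform_monotone_box
    (d : ℕ) (hd : 1 ≤ d) (τ : Fin d → ℝ) (hτ : ∀ j, 0 < τ j)
    (F : ℕ → (Fin d → ℝ) → ℝ) (F₀ : (Fin d → ℝ) → ℝ)
    (hmono : ∀ n, MonotoneOn (F n) (Set.Icc 0 τ))
    (hcont : ContinuousOn F₀ (Set.Icc 0 τ))
    (hpt : ∀ x ∈ Set.Icc 0 τ, Tendsto (fun n => F n x) atTop (𝓝 (F₀ x))) :
    TendstoUniformlyOn F F₀ atTop (Set.Icc 0 τ) := by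
  exact (tendstoLocallyUniformlyOn_iff_tendstoUniformlyOn_of_compact isCompact_Icc).1
    (tendstoLocallyUniformlyOn_Icc_of_monotoneOn hmono hcont hpt)
end

section
/- Let d ≥ 1, let τ ∈ Fin d → ℝ have all coordinates strictly positive, let B = {x : 0 ≤ x ≤ τ} (componentwise), and let μ be a measure on B whose topological support is all of B. Let f : (Fin d → ℝ) → ℝ be such that for every x ∈ B with xⱼ < τⱼ for all j, f(y) → f(x) as y → x within the set {y ∈ B : x ≤ y componentwise}. If f = 0 μ-almost everywhere on B, then f(x) = 0 for every x ∈ B with xⱼ < τⱼ for all j. -/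
open Filter Topology Set MeasureTheory

/-- Every neighborhood of `x` contains a point `y ≤ τ` lying strictly above `x` in every
coordinate, provided `τ` itself lies strictly above `x` in every coordinate. -/
theorem exists_mem_forall_lt_le_of_mem_nhds {ι : Type*} {x τ : ι → ℝ}
    (hx : ∀ j, x j < τ j) {V : Set (ι → ℝ)} (hV : V ∈ 𝓝 x) :
    ∃ y ∈ V, (∀ j, x j < y j) ∧ y ≤ τ := by
  have hcont : Continuous fun ε : ℝ => x + ε • (τ - x) := by fun_prop
  have hlim : Tendsto (fun ε : ℝ => x + ε • (τ - x)) (𝓝[>] 0) (𝓝 x) :=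
    (hcont.tendsto' 0 x (by simp)).mono_left nhdsWithin_le_nhds
  obtain ⟨ε, hεV, hε0, hε1⟩ :=
    ((hlim.eventually_mem hV).and (Ioo_mem_nhdsGT (zero_lt_one' ℝ))).exists
  refine ⟨_, hεV, fun j => ?_, fun j => ?_⟩ <;>
    simp only [Pi.add_apply, Pi.smul_apply, Pi.sub_apply, smul_eq_mul] <;>
    nlinarith [hx j, mul_pos hε0 (sub_pos.2 (hx j))]

/-- **Multivariate content of Lemma 2.**
Let `B = Icc 0 τ` (componentwise order) with all coordinates of `τ` positive, and let `μ` be a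
measure on `B` with full topological support (every nonempty relatively open subset of `B` has
positive measure). Suppose `f` is right-continuous in the multivariate sense at every `x ∈ B`
with `x j < τ j` for all `j`, i.e. continuous at `x` within the upper-right orthant
`{y ∈ B : x ≤ y}`. If `f = 0` `μ`-almost everywhere on `B`, then `f x = 0` at every such `x`. -/
theorem cadlag_ae_zero_eq_zero_multivariate
    (d : ℕ) (hd : 1 ≤ d) (τ : Fin d → ℝ) (hτ : ∀ j, 0 < τ j)
    (μ : Measure (Fin d → ℝ))
    (hsupp : ∀ U : Set (Fin d → ℝ), IsOpen U → (U ∩ Set.Icc 0 τ).Nonempty →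
      0 < μ (U ∩ Set.Icc 0 τ))
    (f : (Fin d → ℝ) → ℝ)
    (hrc : ∀ x ∈ Set.Icc (0 : Fin d → ℝ) τ, (∀ j, x j < τ j) →
      ContinuousWithinAt f (Set.Icc 0 τ ∩ Set.Ici x) x)
    (hae : ∀ᵐ x ∂(μ.restrict (Set.Icc 0 τ)), f x = 0) :
    ∀ x ∈ Set.Icc (0 : Fin d → ℝ) τ, (∀ j, x j < τ j) → f x = 0 := by
  intro x hx hxτ
  by_contra hfx
  obtain ⟨V, hVo, hxV, hV⟩ :=
    mem_nhdsWithin.1 ((hrc x hx hxτ).eventually_ne hfx)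
  have hUo : IsOpen (V ∩ {y | ∀ j, x j < y j}) := by
    refine hVo.inter ?_
    simp only [ofPred_forall]
    exact isOpen_iInter_of_finite fun j => isOpen_lt continuous_const (continuous_apply j)
  obtain ⟨y, hyV, hxy, hyτ⟩ := exists_mem_forall_lt_le_of_mem_nhds hxτ (hVo.mem_nhds hxV)
  refine (hsupp _ hUo ⟨y, ⟨hyV, hxy⟩, hx.1.trans fun j => (hxy j).le, hyτ⟩).ne' ?_
  refine measure_mono_null ?_ ((ae_restrict_iff' measurableSet_Icc).1 hae)
  rintro z ⟨⟨hzV, hxz⟩, hzB⟩ hz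
  exact hV ⟨hzV, hzB, fun j => (hxz j).le⟩ (hz hzB)
end

section
/- In the HAL framework (see context) with assumptions A0, A1 and A3, let (ψₙ) be a sequence in Ψ_M with d₀(ψₙ) → 0. Then for any subsequence (ψ_{n(k)}) and any ψ_∞ ∈ Ψ_M such that ψ_{n(k)}(x) → ψ_∞(x) at every continuity point x of ψ_∞, one has ψ_∞(x) = ψ₀(x) for every x ∈ [0, τ]. -/
open Filter Topology Set MeasureTheory

/-- The class `Ψ_M` of cadlag functions on `[0, τ]` (right-continuous on `[0, τ)`,
left-continuous at `τ`) with variation norm `|f 0| + Var(f; [0, τ]) ≤ M`. -/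
def PsiM (τ M : ℝ) : Set (ℝ → ℝ) :=
  {f | (∀ x ∈ Set.Ico 0 τ, ContinuousWithinAt f (Set.Icc x τ) x) ∧
       ContinuousWithinAt f (Set.Icc 0 τ) τ ∧
       ENNReal.ofReal |f 0| + eVariationOn f (Set.Icc 0 τ) ≤ ENNReal.ofReal M}

/-- If `μ` charges every open set meeting `K`, and `f = g` `μ`-a.e. on `K`, then `f` and `g` agree at
every limit point of an open `V ⊆ K` at which both are continuous along `V`. -/
theorem eq_of_ae_restrict_eq_of_continuousWithinAt {X Y : Type*} [TopologicalSpace X]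
    [MeasurableSpace X] [TopologicalSpace Y] [T2Space Y]
    {μ : Measure X} {K V : Set X} (hK : MeasurableSet K)
    (hsupp : ∀ U : Set X, IsOpen U → (U ∩ K).Nonempty → 0 < μ (U ∩ K))
    (hV : IsOpen V) (hVK : V ⊆ K) {f g : X → Y}
    (hfg : ∀ᵐ y ∂(μ.restrict K), f y = g y) {x : X} (hx : x ∈ closure V)
    (hf : ContinuousWithinAt f V x) (hg : ContinuousWithinAt g V x) : f x = g x := by
  by_contra hne
  have hev : ∀ᶠ y in 𝓝[V] x, f y ≠ g y :=
    (hf.prodMk_nhds hg).eventually_mem (isClosed_diagonal.isOpen_compl.mem_nhds hne)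
  obtain ⟨U, hU, hxU, hUV⟩ := mem_nhdsWithin.1 hev
  have hnonempty : (U ∩ V).Nonempty := mem_closure_iff.1 hx U hU hxU
  have hpos := hsupp (U ∩ V) (hU.inter hV) (hnonempty.mono fun y hy => ⟨hy, hVK hy.2⟩)
  refine hpos.ne' (measure_mono_null ?_ (ae_iff.1 ((ae_restrict_iff' hK).1 hfg)))
  rintro y ⟨hyUV, hyK⟩ hy
  exact hUV hyUV (hy hyK)

/-- Dominated convergence for the risk of a uniformly bounded sequence of losses. -/
theorem tendsto_integral_of_abs_le {Ω : Type*} [MeasurableSpace Ω] {P : Measure Ω}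
    [IsFiniteMeasure P] {F : ℕ → Ω → ℝ} {G : Ω → ℝ} {C : ℝ} (hF : ∀ k, Measurable (F k))
    (hC : ∀ k ω, |F k ω| ≤ C) (hlim : ∀ᵐ ω ∂P, Tendsto (fun k => F k ω) atTop (𝓝 (G ω))) :
    Tendsto (fun k => ∫ ω, F k ω ∂P) atTop (𝓝 (∫ ω, G ω ∂P)) :=
  tendsto_integral_of_dominated_convergence (fun _ => C)
    (fun k => (hF k).aestronglyMeasurable) (integrable_const C)
    (fun k => ae_of_all _ (hC k)) hlim

/-- **Lemma 3, second statement (identification of weak subsequential limits, d = 1).**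
In the HAL framework with assumptions A0, A1 and A3, if `d₀(ψ n) → 0` and a subsequence
`ψ (n k)` converges pointwise to some `ψ∞ ∈ Ψ_M` at every continuity point of `ψ∞`,
then `ψ∞ = ψ₀` everywhere on `[0, τ]`. -/
theorem subsequential_limit_eq_truth
    (τ M : ℝ) (hτ : 0 < τ) (hM : 0 < M)
    {Ω : Type*} [MeasurableSpace Ω] (P : Measure Ω) [IsProbabilityMeasure P]
    (L : (ℝ → ℝ) → Ω → ℝ) (C : ℝ)
    (hLmeas : ∀ ψ ∈ PsiM τ M, Measurable (L ψ))
    -- A0: uniformly bounded loss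
    (hA0 : ∀ ψ ∈ PsiM τ M, ∀ ω, |L ψ ω| ≤ C)
    -- the truth ψ₀: continuous risk minimizer in Ψ_M
    (ψ₀ : ℝ → ℝ) (hψ₀ : ψ₀ ∈ PsiM τ M)
    (hψ₀cont : ContinuousOn ψ₀ (Set.Icc 0 τ))
    (hmin : ∀ ψ ∈ PsiM τ M, ∫ ω, L ψ₀ ω ∂P ≤ ∫ ω, L ψ ω ∂P)
    -- a measure μ on [0, τ] with full topological support
    (μ : Measure ℝ)
    (hsupp : ∀ U : Set ℝ, IsOpen U → (U ∩ Set.Icc 0 τ).Nonempty →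
      0 < μ (U ∩ Set.Icc 0 τ))
    -- A1: zero dissimilarity implies μ-a.e. equality with ψ₀
    (hA1 : ∀ ψ ∈ PsiM τ M, (∫ ω, L ψ ω ∂P) - (∫ ω, L ψ₀ ω ∂P) = 0 →
      ∀ᵐ x ∂(μ.restrict (Set.Icc 0 τ)), ψ x = ψ₀ x)
    -- A3: pointwise convergence at continuity points implies a.e. convergence of the loss
    (hA3 : ∀ (φ : ℕ → ℝ → ℝ), (∀ k, φ k ∈ PsiM τ M) → ∀ φinf ∈ PsiM τ M,
      (∀ x ∈ Set.Icc 0 τ, ContinuousWithinAt φinf (Set.Icc 0 τ) x →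
        Tendsto (fun k => φ k x) atTop (𝓝 (φinf x))) →
      ∀ᵐ ω ∂P, Tendsto (fun k => L (φ k) ω) atTop (𝓝 (L φinf ω)))
    -- the risk-consistent sequence
    (ψ : ℕ → ℝ → ℝ) (hψ : ∀ n, ψ n ∈ PsiM τ M)
    (hd₀ : Tendsto (fun n => (∫ ω, L (ψ n) ω ∂P) - ∫ ω, L ψ₀ ω ∂P) atTop (𝓝 0))
    -- a weakly converging subsequence
    (n : ℕ → ℕ) (hn : StrictMono n)
    (ψinf : ℝ → ℝ) (hψinf : ψinf ∈ PsiM τ M)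
    (hpt : ∀ x ∈ Set.Icc 0 τ, ContinuousWithinAt ψinf (Set.Icc 0 τ) x →
      Tendsto (fun k => ψ (n k) x) atTop (𝓝 (ψinf x))) :
    ∀ x ∈ Set.Icc 0 τ, ψinf x = ψ₀ x := by
  have hrisk : Tendsto (fun k => ∫ ω, L (ψ (n k)) ω ∂P) atTop (𝓝 (∫ ω, L ψinf ω ∂P)) :=
    tendsto_integral_of_abs_le (fun k => hLmeas _ (hψ (n k))) (fun k => hA0 _ (hψ (n k)))
      (hA3 (fun k => ψ (n k)) (fun k => hψ (n k)) ψinf hψinf hpt)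
  have hae := hA1 ψinf hψinf
    (tendsto_nhds_unique (hrisk.sub_const _) (hd₀.comp hn.tendsto_atTop))
  intro x hx
  rcases hx.2.lt_or_eq with hxτ | rfl
  · have hsub : Ioo x τ ⊆ Icc 0 τ := Ioo_subset_Icc_self.trans (Icc_subset_Icc_left hx.1)
    refine eq_of_ae_restrict_eq_of_continuousWithinAt measurableSet_Icc hsupp isOpen_Ioo hsub hae
      ?_ ((hψinf.1 x ⟨hx.1, hxτ⟩).mono Ioo_subset_Icc_self) ((hψ₀cont x hx).mono hsub)
    rw [closure_Ioo hxτ.ne]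
    exact left_mem_Icc.2 hxτ.le
  · refine eq_of_ae_restrict_eq_of_continuousWithinAt measurableSet_Icc hsupp isOpen_Ioo
      Ioo_subset_Icc_self hae ?_ (hψinf.2.1.mono Ioo_subset_Icc_self)
      ((hψ₀cont x hx).mono Ioo_subset_Icc_self)
    rw [closure_Ioo hτ.ne]
    exact hx
end

section
/- Let d ≥ 1, let τ ∈ Fin d → ℝ have all coordinates strictly positive, and let B = {x : 0 ≤ x ≤ τ} (componentwise). Let (Fₙ), (Gₙ) be sequences of functions (Fin d → ℝ) → ℝ that are monotone nondecreasing on B with respect to the componentwise partial order, and suppose Fₙ(x) → F₀(x) and Gₙ(x) → G₀(x) for every x ∈ B, where F₀ and G₀ are continuous on B. Then ψₙ = Fₙ − Gₙ converges uniformly on B to ψ₀ = F₀ − G₀, i.e. sup_{x ∈ B} |ψₙ(x) − ψ₀(x)| → 0. -/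
open Filter Topology Set

/-- Pólya's theorem on boxes: if functions monotone on a box converge pointwise there to a
continuous function, then the convergence is uniform on the box. -/
theorem tendstoUniformlyOn_Icc_of_monotoneOn_of_continuousOn {ι α : Type*} [Fintype ι]
    {p : Filter α} {l u : ι → ℝ} {F : α → (ι → ℝ) → ℝ} {f : (ι → ℝ) → ℝ}
    (hF : ∀ n, MonotoneOn (F n) (Icc l u)) (hf : ContinuousOn f (Icc l u))
    (h : ∀ x ∈ Icc l u, Tendsto (fun n => F n x) p (𝓝 (f x))) :
    TendstoUniformlyOn F f p (Icc l u) := by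
  rw [← tendstoLocallyUniformlyOn_iff_tendstoUniformlyOn_of_compact isCompact_Icc,
    Metric.tendstoLocallyUniformlyOn_iff]
  intro ε hε x hx
  obtain ⟨δ, hδ, hfδ⟩ := Metric.continuousOn_iff.1 hf x hx (ε / 4) (by positivity)
  let r : ι → ℝ := fun _ => δ / 2
  have hr : 0 ≤ r := fun _ => by positivity
  have ball_eq : Metric.closedBall x (δ / 2) = Icc (x - r) (x + r) := by
    simp only [closedBall_pi x (half_pos hδ).le, Real.closedBall_eq_Icc, ← pi_univ_Icc,
      Pi.sub_apply, Pi.add_apply, r]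
  have near {y : ι → ℝ} (hy : y ∈ Icc l u) (hyr : y ∈ Icc (x - r) (x + r)) :
      |f y - f x| < ε / 4 :=
    hfδ y hy ((Metric.mem_closedBall.1 (ball_eq ▸ hyr)).trans_lt (half_lt_self hδ))
  have hxl : x - r ≤ x := sub_le_self x hr
  have hxu : x ≤ x + r := le_add_of_nonneg_right hr
  have ha : l ⊔ (x - r) ∈ Icc l u := ⟨le_sup_left, sup_le (hx.1.trans hx.2) (hxl.trans hx.2)⟩
  have hb : u ⊓ (x + r) ∈ Icc l u := ⟨le_inf (hx.1.trans hx.2) (hx.1.trans hxu), inf_le_left⟩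
  have hfa := abs_lt.1 (near ha ⟨le_sup_right, (sup_le hx.1 hxl).trans hxu⟩)
  have hfb := abs_lt.1 (near hb ⟨hxl.trans (le_inf hx.2 hxu), inf_le_right⟩)
  refine ⟨Icc l u ∩ Metric.closedBall x (δ / 2),
    inter_mem_nhdsWithin _ (Metric.closedBall_mem_nhds x (half_pos hδ)), ?_⟩
  filter_upwards [Metric.tendsto_nhds.1 (h _ ha) (ε / 4) (by positivity),
    Metric.tendsto_nhds.1 (h _ hb) (ε / 4) (by positivity)] with n hna hnb y hy
  rw [ball_eq] at hy
  obtain ⟨hy, hyr⟩ := hy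
  have hay := hF n ha hy (sup_le hy.1 hyr.1)
  have hyb := hF n hy hb (le_inf hy.2 hyr.2)
  have hfy := abs_lt.1 (near hy hyr)
  rw [Real.dist_eq, abs_lt] at hna hnb ⊢
  constructor <;> linarith

/-- **Final step of the proof of Theorem 1 (multivariate).**
If `F n, G n` are monotone nondecreasing on the box `B = Icc 0 τ` (componentwise order,
`τ` with strictly positive coordinates) and converge pointwise on `B` to `F₀, G₀` which are
continuous on `B`, then `ψ n = F n - G n` converges uniformly on `B` to `ψ₀ = F₀ - G₀`. -/
theorem uniform_convergence_of_difference_of_monotone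
    (d : ℕ) (hd : 1 ≤ d) (τ : Fin d → ℝ) (hτ : ∀ j, 0 < τ j)
    (F G : ℕ → (Fin d → ℝ) → ℝ) (F₀ G₀ : (Fin d → ℝ) → ℝ)
    (hFmono : ∀ n, MonotoneOn (F n) (Set.Icc 0 τ))
    (hGmono : ∀ n, MonotoneOn (G n) (Set.Icc 0 τ))
    (hF₀cont : ContinuousOn F₀ (Set.Icc 0 τ))
    (hG₀cont : ContinuousOn G₀ (Set.Icc 0 τ))
    (hFpt : ∀ x ∈ Set.Icc 0 τ, Tendsto (fun n => F n x) atTop (𝓝 (F₀ x)))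
    (hGpt : ∀ x ∈ Set.Icc 0 τ, Tendsto (fun n => G n x) atTop (𝓝 (G₀ x))) :
    TendstoUniformlyOn (fun n x => F n x - G n x) (fun x => F₀ x - G₀ x)
      atTop (Set.Icc 0 τ) := by
  exact (tendstoUniformlyOn_Icc_of_monotoneOn_of_continuousOn hFmono hF₀cont hFpt).sub
    (tendstoUniformlyOn_Icc_of_monotoneOn_of_continuousOn hGmono hG₀cont hGpt)
end
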